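/- Let a ∈ ℝ. On the domain {x ∈ ℝ³ : x₁ > 0, x₂ > 0, x₃ > 0}, set g(x) = (x₁x₂x₃)^{1/3} (real cube root) and define H(J,x) = J₁² + J₂² + J₃² − a² (x₁² + x₂² + x₃²)/g(x)² and K(J,x) = J₁ J₂ J₃ + a² g(x) ( J₁/x₁ + J₂/x₂ + J₃/x₃ ). Then for every (J,x) with x₁,x₂,x₃ > 0 and J₁x₁ + J₂x₂ + J₃x₃ = 0, the e(3) Lie–Poisson bracket of H and K vanishes: {H, K}(J,x) = 0. Thus the deformed spherical top is completely integrable on the orbits with c₂ = (J,x) = 0 of the real algebra e*(3). -/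

import Mathlib

/-- The Levi-Civita symbol on `Fin 3`: totally antisymmetric with `eps 0 1 2 = 1`. -/
def eps (i j k : Fin 3) : ℤ :=
  (((j : ℤ) - (i : ℤ)) * ((k : ℤ) - (i : ℤ)) * ((k : ℤ) - (j : ℤ))) / 2

/-- Partial derivative of `F(J,x)` with respect to `J_i`. -/
noncomputable def pdJ (F : (Fin 3 → ℝ) × (Fin 3 → ℝ) → ℝ)
    (p : (Fin 3 → ℝ) × (Fin 3 → ℝ)) (i : Fin 3) : ℝ :=
  fderiv ℝ F p (Pi.single i 1, 0)

/-- Partial derivative of `F(J,x)` with respect to `x_i`. -/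
noncomputable def pdx (F : (Fin 3 → ℝ) × (Fin 3 → ℝ) → ℝ)
    (p : (Fin 3 → ℝ) × (Fin 3 → ℝ)) (i : Fin 3) : ℝ :=
  fderiv ℝ F p (0, Pi.single i 1)

/-- The Lie–Poisson bracket of `e(3)` on functions of `(J,x) ∈ ℝ³ × ℝ³`:
`{F,G} = Σ_{i,j,k} ε_{ijk} [ J_k F_{J_i} G_{J_j} + x_k (F_{J_i} G_{x_j} + F_{x_i} G_{J_j}) ]`. -/
noncomputable def e3Bracket (F G : (Fin 3 → ℝ) × (Fin 3 → ℝ) → ℝ)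
    (p : (Fin 3 → ℝ) × (Fin 3 → ℝ)) : ℝ :=
  ∑ i : Fin 3, ∑ j : Fin 3, ∑ k : Fin 3,
    (eps i j k : ℝ) *
      (p.1 k * pdJ F p i * pdJ G p j +
       p.2 k * (pdJ F p i * pdx G p j + pdx F p i * pdJ G p j))

/-- The real cube root `g(x) = (x₁x₂x₃)^{1/3}` on the positive octant. -/
noncomputable def gcube (x : Fin 3 → ℝ) : ℝ := (x 0 * x 1 * x 2) ^ ((1 : ℝ) / 3)

/-- The Hamiltonian `H = (J,J) − a² (x,x)/(x₁x₂x₃)^{2/3}` of the deformed spherical top. -/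
noncomputable def Hdef (a : ℝ) (p : (Fin 3 → ℝ) × (Fin 3 → ℝ)) : ℝ :=
  p.1 0 ^ 2 + p.1 1 ^ 2 + p.1 2 ^ 2 -
    a ^ 2 * (p.2 0 ^ 2 + p.2 1 ^ 2 + p.2 2 ^ 2) / gcube p.2 ^ 2

/-- The second integral `K = J₁J₂J₃ + a² (x₁x₂x₃)^{1/3}(J₁/x₁ + J₂/x₂ + J₃/x₃)`. -/
noncomputable def Kdef (a : ℝ) (p : (Fin 3 → ℝ) × (Fin 3 → ℝ)) : ℝ :=
  p.1 0 * p.1 1 * p.1 2 +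
    a ^ 2 * gcube p.2 * (p.1 0 / p.2 0 + p.1 1 / p.2 1 + p.1 2 / p.2 2)

lemma gcube_line (x w : Fin 3 → ℝ) (h0 : 0 < x 0) (h1 : 0 < x 1) (h2 : 0 < x 2) :
    HasDerivAt (fun t : ℝ => gcube (x + t • w))
      (gcube x / 3 * (w 0 / x 0 + w 1 / x 1 + w 2 / x 2)) 0 := by
  have hc : ∀ i, HasDerivAt (fun t : ℝ => x i + t * w i) (w i) 0 := fun i => by
    simpa using ((hasDerivAt_id (0 : ℝ)).mul_const (w i)).const_add (x i)
  have hp : 0 < x 0 * x 1 * x 2 := by positivity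
  have h := (((hc 0).mul (hc 1)).mul (hc 2)).rpow_const (p := (1 : ℝ) / 3)
    (Or.inl (by simp; exact ⟨⟨h0.ne', h1.ne'⟩, h2.ne'⟩))
  refine h.congr_deriv ?_
  simp only [Pi.mul_apply, zero_mul, add_zero, gcube]
  rw [Real.rpow_sub_one hp.ne']
  field_simp

lemma gcube_diff (J x : Fin 3 → ℝ) (h0 : 0 < x 0) (h1 : 0 < x 1) (h2 : 0 < x 2) :
    DifferentiableAt ℝ (fun p : (Fin 3 → ℝ) × (Fin 3 → ℝ) => gcube p.2) (J, x) := by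
  have hp : x 0 * x 1 * x 2 ≠ 0 := by positivity
  unfold gcube
  refine DifferentiableAt.rpow_const (by fun_prop) (Or.inl hp)

lemma gcube_pos (x : Fin 3 → ℝ) (h0 : 0 < x 0) (h1 : 0 < x 1) (h2 : 0 < x 2) :
    0 < gcube x := Real.rpow_pos_of_pos (by positivity) _

lemma gcube_cube (x : Fin 3 → ℝ) (h0 : 0 < x 0) (h1 : 0 < x 1) (h2 : 0 < x 2) :
    gcube x ^ 3 = x 0 * x 1 * x 2 := by
  unfold gcube
  rw [← Real.rpow_natCast, ← Real.rpow_mul (by positivity)]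
  norm_num

lemma e3Bracket_explicit (F G : (Fin 3 → ℝ) × (Fin 3 → ℝ) → ℝ) (J x : Fin 3 → ℝ) :
    e3Bracket F G (J, x) =
      let f := pdJ F (J, x)
      let g := pdJ G (J, x)
      let fx := pdx F (J, x)
      let gx := pdx G (J, x)
      J 2 * (f 0 * g 1 - f 1 * g 0) + J 0 * (f 1 * g 2 - f 2 * g 1)
        + J 1 * (f 2 * g 0 - f 0 * g 2)
      + x 2 * (f 0 * gx 1 - f 1 * gx 0 + fx 0 * g 1 - fx 1 * g 0)
      + x 0 * (f 1 * gx 2 - f 2 * gx 1 + fx 1 * g 2 - fx 2 * g 1)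
      + x 1 * (f 2 * gx 0 - f 0 * gx 2 + fx 2 * g 0 - fx 0 * g 2) := by
  simp only [e3Bracket, Fin.sum_univ_three]
  have e012 : eps 0 1 2 = 1 := by decide
  have e120 : eps 1 2 0 = 1 := by decide
  have e201 : eps 2 0 1 = 1 := by decide
  have e021 : eps 0 2 1 = -1 := by decide
  have e210 : eps 2 1 0 = -1 := by decide
  have e102 : eps 1 0 2 = -1 := by decide
  have d1 : ∀ i j, eps i i j = 0 := by decide
  have d2 : ∀ i j, eps i j i = 0 := by decide
  have d3 : ∀ i j, eps j i i = 0 := by decide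
  simp only [e012, e120, e201, e021, e210, e102, d1, d2, d3]
  push_cast
  ring

lemma diffAt_quot {E : Type*} [NormedAddCommGroup E] [NormedSpace ℝ E] {f g : E → ℝ} {p : E}
    (hf : DifferentiableAt ℝ f p) (hg : DifferentiableAt ℝ g p) (h : g p ≠ 0) :
    DifferentiableAt ℝ (fun q => f q / g q) p := by
  simp only [div_eq_mul_inv]
  exact hf.fun_mul (hg.fun_inv h)

lemma Hdef_fderiv (a : ℝ) (J x u w : Fin 3 → ℝ) (h0 : 0 < x 0) (h1 : 0 < x 1) (h2 : 0 < x 2) :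
    fderiv ℝ (Hdef a) (J, x) (u, w) =
      2 * (J 0 * u 0 + J 1 * u 1 + J 2 * u 2)
      - a ^ 2 * (2 * (x 0 * w 0 + x 1 * w 1 + x 2 * w 2)
        - 2 / 3 * (x 0 ^ 2 + x 1 ^ 2 + x 2 ^ 2) * (w 0 / x 0 + w 1 / x 1 + w 2 / x 2))
        / gcube x ^ 2 := by
  have hg := gcube_pos x h0 h1 h2
  have hd : DifferentiableAt ℝ (Hdef a) (J, x) := by
    have := gcube_diff J x h0 h1 h2
    unfold Hdef
    refine DifferentiableAt.fun_sub (by fun_prop) (diffAt_quot ?_ ?_ ?_)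
    · fun_prop
    · fun_prop
    exact (pow_pos hg 2).ne'
  rw [← hd.lineDeriv_eq_fderiv]
  have hc : ∀ (y v : Fin 3 → ℝ) i, HasDerivAt (fun t : ℝ => (y + t • v) i) (v i) 0 :=
    fun y v i => by
      simpa using ((hasDerivAt_id (0 : ℝ)).mul_const (v i)).const_add (y i)
  have h := (((((hc J u 0).fun_pow 2).fun_add ((hc J u 1).fun_pow 2)).fun_add
      ((hc J u 2).fun_pow 2))).fun_sub
    ((((((hc x w 0).fun_pow 2).fun_add ((hc x w 1).fun_pow 2)).fun_add
      ((hc x w 2).fun_pow 2)).const_mul (a ^ 2)).fun_div ((gcube_line x w h0 h1 h2).fun_pow 2)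
      (by simpa using hg.ne'))
  refine (h.deriv).trans ?_
  simp only [zero_smul, add_zero]
  field_simp
  ring

lemma Kdef_fderiv (a : ℝ) (J x u w : Fin 3 → ℝ) (h0 : 0 < x 0) (h1 : 0 < x 1) (h2 : 0 < x 2) :
    fderiv ℝ (Kdef a) (J, x) (u, w) =
      u 0 * J 1 * J 2 + J 0 * u 1 * J 2 + J 0 * J 1 * u 2
      + a ^ 2 * gcube x * (1 / 3 * (w 0 / x 0 + w 1 / x 1 + w 2 / x 2)
          * (J 0 / x 0 + J 1 / x 1 + J 2 / x 2)
        + (u 0 / x 0 + u 1 / x 1 + u 2 / x 2)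
        - (J 0 * w 0 / x 0 ^ 2 + J 1 * w 1 / x 1 ^ 2 + J 2 * w 2 / x 2 ^ 2)) := by
  have hg := gcube_pos x h0 h1 h2
  have hd : DifferentiableAt ℝ (Kdef a) (J, x) := by
    have := gcube_diff J x h0 h1 h2
    unfold Kdef
    refine DifferentiableAt.fun_add (by fun_prop) (DifferentiableAt.fun_mul (by fun_prop) ?_)
    refine DifferentiableAt.fun_add (DifferentiableAt.fun_add ?_ ?_) ?_
    · refine diffAt_quot ?_ ?_ h0.ne' <;> fun_prop
    · refine diffAt_quot ?_ ?_ h1.ne' <;> fun_prop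
    · refine diffAt_quot ?_ ?_ h2.ne' <;> fun_prop
  rw [← hd.lineDeriv_eq_fderiv]
  have hc : ∀ (y v : Fin 3 → ℝ) i, HasDerivAt (fun t : ℝ => (y + t • v) i) (v i) 0 :=
    fun y v i => by
      simpa using ((hasDerivAt_id (0 : ℝ)).mul_const (v i)).const_add (y i)
  have h := (((hc J u 0).fun_mul (hc J u 1)).fun_mul (hc J u 2)).fun_add
    (((gcube_line x w h0 h1 h2).const_mul (a ^ 2)).fun_mul
      ((((hc J u 0).fun_div (hc x w 0) (by simpa using h0.ne')).fun_add
        ((hc J u 1).fun_div (hc x w 1) (by simpa using h1.ne'))).fun_add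
        ((hc J u 2).fun_div (hc x w 2) (by simpa using h2.ne'))))
  refine (h.deriv).trans ?_
  simp only [zero_smul, add_zero]
  field_simp
  ring

/-- The deformed spherical top is completely integrable on the orbits with
`c₂ = (J,x) = 0` of the real algebra `e*(3)`: on the domain `x₁,x₂,x₃ > 0`,
the `e(3)` Lie–Poisson bracket of `H` and `K` vanishes whenever `(J,x) = 0`. -/
theorem deformed_spherical_top_integrable_c2_zero (a : ℝ) :
    ∀ (J : Fin 3 → ℝ) (x : Fin 3 → ℝ),
      0 < x 0 → 0 < x 1 → 0 < x 2 →
      J 0 * x 0 + J 1 * x 1 + J 2 * x 2 = 0 →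
      e3Bracket (Hdef a) (Kdef a) (J, x) = 0 := by
  intro J x h0 h1 h2 hJ
  have hg := gcube_pos x h0 h1 h2
  have hg3 := gcube_cube x h0 h1 h2
  have hinv : ∀ y : ℝ, y / gcube x ^ 2 = y * gcube x / (x 0 * x 1 * x 2) := fun y => by
    rw [← hg3]; field_simp
  have hJ2 : J 2 = -(J 0 * x 0 + J 1 * x 1) / x 2 := by
    field_simp; linarith
  rw [e3Bracket_explicit]
  simp only [pdJ, pdx, Hdef_fderiv a J x _ _ h0 h1 h2, Kdef_fderiv a J x _ _ h0 h1 h2, hinv]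
  simp
  rw [hJ2]
  generalize gcube x = g at *
  field_simp
  ring
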